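/- arXiv:2412.01997 — 3 statements merged into one kernel-verified Lean document; each statement's English description precedes it below -/
import Mathlib

section
/- Let γ ∈ (0,1), let r₁, r₂ ∈ (1,∞), and let c₁, c₂, c₃ > 0 be real numbers. For λ > 0 define g_λ : [0,∞) → ℝ by g_λ(t) = t − c₁ λ t^{γ} − c₂ t^{r₁} − c₃ t^{r₂}. Then there exists λ⋆ > 0 such that for every λ ∈ (0, λ⋆) there exist real numbers 0 < R₁ < R₂ with g_λ(t) < 0 for all t ∈ (0, R₁) ∪ (R₂, ∞) and g_λ(t) > 0 for all t ∈ (R₁, R₂). -/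
/-- A strictly concave continuous function on `[0, ∞)` that lies below the level `d` at `0`, above it
at `x`, and below it at some `y > x` crosses `d` exactly twice. -/
theorem StrictConcaveOn.exists_sign_change {f : ℝ → ℝ} (hf : StrictConcaveOn ℝ (Set.Ici 0) f)
    (hcont : Continuous f) {d x y : ℝ} (hx : 0 < x) (hxy : x < y)
    (h₀ : f 0 < d) (hfx : d < f x) (hfy : f y < d) :
    ∃ a b : ℝ, 0 < a ∧ a < b ∧ (∀ s, 0 ≤ s → s < a ∨ b < s → f s < d) ∧
      ∀ s, a < s → s < b → d < f s := by
  obtain ⟨a, ⟨ha₀, hax⟩, hfa⟩ := intermediate_value_Ioo hx.le hcont.continuousOn ⟨h₀, hfx⟩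
  obtain ⟨b, ⟨hxb, -⟩, hfb⟩ := intermediate_value_Ioo' hxy.le hcont.continuousOn ⟨hfy, hfx⟩
  have hab : a < b := hax.trans hxb
  have key : ∀ u v w : ℝ, 0 ≤ u → u < v → v < w → min (f u) (f w) < f v := by
    intro u v w hu huv hvw
    refine hf.lt_on_openSegment hu (hu.trans (huv.trans hvw).le) (huv.trans hvw).ne ?_
    rw [openSegment_eq_Ioo (huv.trans hvw)]
    exact ⟨huv, hvw⟩
  refine ⟨a, b, ha₀, hab, ?_, ?_⟩
  · rintro s hs (hsa | hbs)
    · simpa [hfa, hfb] using key s a b hs hsa hab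
    · simpa [hfa, hfb] using key a b s ha₀.le hab hbs
  · intro s has hsb
    simpa [hfa, hfb] using key a s b ha₀.le has hsb

section PowerPerturbation

variable {p q c e : ℝ}

theorem strictConcaveOn_sub_rpow_sub_rpow (hp : 1 < p) (hq : 1 < q) (hc : 0 < c) (he : 0 < e) :
    StrictConcaveOn ℝ (Set.Ici 0) fun s : ℝ => s - c * s ^ p - e * s ^ q := by
  refine ⟨convex_Ici 0, fun x hx y hy hxy a b ha hb hab => ?_⟩
  have h₁ := mul_lt_mul_of_pos_left ((strictConvexOn_rpow hp).2 hx hy hxy ha hb hab) hc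
  have h₂ := mul_lt_mul_of_pos_left ((strictConvexOn_rpow hq).2 hx hy hxy ha hb hab) he
  simp only [smul_eq_mul] at *
  linarith

theorem exists_pos_sub_rpow_sub_rpow_pos (hp : 1 < p) (hq : 1 < q) :
    ∃ s : ℝ, 0 < s ∧ 0 < s - c * s ^ p - e * s ^ q := by
  have hcont : Continuous fun s : ℝ => 1 - c * s ^ (p - 1) - e * s ^ (q - 1) := by
    have h₁ := Real.continuous_rpow_const (q := p - 1) (by linarith)
    have h₂ := Real.continuous_rpow_const (q := q - 1) (by linarith)
    fun_prop
  have h₀ : ∀ᶠ s : ℝ in nhds 0, 0 < 1 - c * s ^ (p - 1) - e * s ^ (q - 1) := by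
    refine hcont.continuousAt.eventually_const_lt ?_
    simp [Real.zero_rpow (sub_pos.2 hp).ne', Real.zero_rpow (sub_pos.2 hq).ne']
  obtain ⟨s, hs, hs₀⟩ :=
    ((h₀.filter_mono nhdsWithin_le_nhds).and (self_mem_nhdsWithin (s := Set.Ioi (0 : ℝ)))).exists
  have hs₀ : 0 < s := hs₀
  refine ⟨s, hs₀, ?_⟩
  have h := mul_pos hs₀ hs
  rw [Real.rpow_sub_one hs₀.ne', Real.rpow_sub_one hs₀.ne'] at h
  field_simp at h
  linarith

theorem exists_gt_sub_rpow_sub_rpow_nonpos (hp : 1 < p) (hc : 0 < c) (he : 0 < e) (x : ℝ) :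
    ∃ s : ℝ, x < s ∧ s - c * s ^ p - e * s ^ q ≤ 0 := by
  obtain ⟨s, h, hxs, hs₀⟩ := (((tendsto_rpow_atTop (sub_pos.2 hp)).eventually_ge_atTop c⁻¹).and
    ((Filter.eventually_gt_atTop x).and (Filter.eventually_gt_atTop 0))).exists
  refine ⟨s, hxs, ?_⟩
  rw [Real.rpow_sub_one hs₀.ne', inv_le_iff_one_le_mul₀' hc, ← mul_div_assoc, one_le_div hs₀] at h
  have := mul_pos he (Real.rpow_pos_of_pos hs₀ q)
  linarith

end PowerPerturbation

/-- Sign structure of the truncation function `g_λ(t) = t − c₁ λ t^γ − c₂ t^{r₁} − c₃ t^{r₂}`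
for `γ ∈ (0,1)` and `r₁, r₂ ∈ (1,∞)`: there is `λ⋆ > 0` such that for every
`λ ∈ (0, λ⋆)` there are `0 < R₁ < R₂` with `g_λ < 0` on `(0, R₁) ∪ (R₂, ∞)` and
`g_λ > 0` on `(R₁, R₂)`. -/
theorem stmt_6 (γ r₁ r₂ c₁ c₂ c₃ : ℝ)
    (hγ₀ : 0 < γ) (hγ₁ : γ < 1) (hr₁ : 1 < r₁) (hr₂ : 1 < r₂)
    (hc₁ : 0 < c₁) (hc₂ : 0 < c₂) (hc₃ : 0 < c₃) :
    ∃ lamstar > (0 : ℝ), ∀ lam : ℝ, 0 < lam → lam < lamstar →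
      ∃ R₁ R₂ : ℝ, 0 < R₁ ∧ R₁ < R₂ ∧
        (∀ t : ℝ, (0 < t ∧ t < R₁) ∨ R₂ < t →
          t - c₁ * lam * t ^ γ - c₂ * t ^ r₁ - c₃ * t ^ r₂ < 0) ∧
        (∀ t : ℝ, R₁ < t → t < R₂ →
          0 < t - c₁ * lam * t ^ γ - c₂ * t ^ r₁ - c₃ * t ^ r₂) := by
  have hδ : 0 < 1 - γ := sub_pos.2 hγ₁
  have hp : 1 < (r₁ - γ) / (1 - γ) := by rw [one_lt_div hδ]; linarith
  have hq : 1 < (r₂ - γ) / (1 - γ) := by rw [one_lt_div hδ]; linarith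
  set p := (r₁ - γ) / (1 - γ) with hp_def
  set q := (r₂ - γ) / (1 - γ) with hq_def
  obtain ⟨x, hx, hfx⟩ := exists_pos_sub_rpow_sub_rpow_pos (c := c₂) (e := c₃) hp hq
  obtain ⟨y, hxy, hfy⟩ := exists_gt_sub_rpow_sub_rpow_nonpos (q := q) hp hc₂ hc₃ x
  have hcont : Continuous fun s : ℝ => s - c₂ * s ^ p - c₃ * s ^ q := by
    have h₁ := Real.continuous_rpow_const (q := p) (by linarith)
    have h₂ := Real.continuous_rpow_const (q := q) (by linarith)
    fun_prop
  refine ⟨(x - c₂ * x ^ p - c₃ * x ^ q) / c₁, div_pos hfx hc₁, fun lam hlam hlt => ?_⟩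
  rw [lt_div_iff₀' hc₁] at hlt
  have hd : 0 < c₁ * lam := mul_pos hc₁ hlam
  obtain ⟨a, b, ha, hab, hout, hin⟩ :=
    (strictConcaveOn_sub_rpow_sub_rpow hp hq hc₂ hc₃).exists_sign_change hcont hx hxy
      (by simpa [Real.zero_rpow (zero_lt_one.trans hp).ne',
        Real.zero_rpow (zero_lt_one.trans hq).ne'] using hd) hlt (hfy.trans_lt hd)
  have hfactor : ∀ t : ℝ, 0 < t → t - c₁ * lam * t ^ γ - c₂ * t ^ r₁ - c₃ * t ^ r₂ =
      t ^ γ * (t ^ (1 - γ) - c₂ * (t ^ (1 - γ)) ^ p - c₃ * (t ^ (1 - γ)) ^ q - c₁ * lam) := by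
    intro t ht
    have e₀ : t ^ γ * t ^ (1 - γ) = t := by
      rw [← Real.rpow_add ht, add_sub_cancel, Real.rpow_one]
    have e₁ : ∀ r, t ^ γ * (t ^ (1 - γ)) ^ ((r - γ) / (1 - γ)) = t ^ r := by
      intro r
      rw [← Real.rpow_mul ht.le, mul_div_cancel₀ _ hδ.ne', ← Real.rpow_add ht, add_sub_cancel]
    linear_combination -e₀ + c₂ * e₁ r₁ + c₃ * e₁ r₂
  have hb : 0 < b := ha.trans hab
  have ha' : 0 < a ^ (1 - γ)⁻¹ := Real.rpow_pos_of_pos ha _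
  have hab' : a ^ (1 - γ)⁻¹ < b ^ (1 - γ)⁻¹ := Real.rpow_lt_rpow ha.le hab (inv_pos.2 hδ)
  refine ⟨a ^ (1 - γ)⁻¹, b ^ (1 - γ)⁻¹, ha', hab', fun t ht => ?_, fun t hat htb => ?_⟩
  · have ht₀ : 0 < t := ht.elim And.left (ha'.trans hab').trans
    rw [hfactor t ht₀]
    refine mul_neg_of_pos_of_neg (Real.rpow_pos_of_pos ht₀ γ) (sub_neg.2 ?_)
    refine hout _ (Real.rpow_nonneg ht₀.le _) (ht.imp (fun h => ?_) fun h => ?_)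
    · exact (Real.lt_rpow_inv_iff_of_pos ht₀.le ha.le hδ).1 h.2
    · exact (Real.rpow_inv_lt_iff_of_pos hb.le ht₀.le hδ).1 h
  · have ht₀ : 0 < t := ha'.trans hat
    rw [hfactor t ht₀]
    refine mul_pos (Real.rpow_pos_of_pos ht₀ γ) (sub_pos.2 (hin _ ?_ ?_))
    · exact (Real.rpow_inv_lt_iff_of_pos ha.le ht₀.le hδ).1 hat
    · exact (Real.lt_rpow_inv_iff_of_pos ht₀.le hb.le hδ).1 htb
end

section
/- Let γ ∈ (0,1), let r₁, r₂ ∈ (1,∞), and let c₁, c₂, c₃ > 0 be real numbers. For λ > 0 define g_λ : [0,∞) → ℝ by g_λ(t) = t − c₁ λ t^{γ} − c₂ t^{r₁} − c₃ t^{r₂}. Then there exists λ⋆ > 0 such that for every λ ∈ (0, λ⋆) the set {t > 0 : g_λ(t) > 0} is nonempty and its infimum R₁(λ) satisfies 0 < R₁(λ) ≤ λ. In particular R₁(λ) → 0 as λ → 0⁺. -/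
open Filter

/-- Points where `t - c₁ λ t^γ - c₂ t^{r₁} - c₃ t^{r₂}` is positive are bounded below by
`(c₁ λ)^{1/(1-γ)}`. -/
theorem rpow_le_of_truncation_pos {γ r₁ r₂ c₁ c₂ c₃ lam t : ℝ} (hγ₁ : γ < 1)
    (hc₁ : 0 < c₁) (hc₂ : 0 < c₂) (hc₃ : 0 < c₃) (hlam : 0 < lam) (ht : 0 < t)
    (h : 0 < t - c₁ * lam * t ^ γ - c₂ * t ^ r₁ - c₃ * t ^ r₂) :
    (c₁ * lam) ^ (1 - γ)⁻¹ ≤ t := by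
  have h₂ : 0 < c₂ * t ^ r₁ := by positivity
  have h₃ : 0 < c₃ * t ^ r₂ := by positivity
  have hle : c₁ * lam ≤ t ^ (1 - γ) := by
    rw [Real.rpow_sub ht, Real.rpow_one, le_div_iff₀ (by positivity)]
    linarith
  calc (c₁ * lam) ^ (1 - γ)⁻¹ ≤ (t ^ (1 - γ)) ^ (1 - γ)⁻¹ :=
        Real.rpow_le_rpow (by positivity) hle (inv_nonneg.2 (by linarith))
    _ = t := Real.rpow_rpow_inv ht.le (by linarith)

/-- For all small `x > 0`, the truncation function with parameter `x` is positive at `x`. -/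
theorem exists_truncation_self_pos {γ r₁ r₂ : ℝ} (c₁ c₂ c₃ : ℝ)
    (hγ₀ : 0 < γ) (hr₁ : 1 < r₁) (hr₂ : 1 < r₂) :
    ∃ δ > (0 : ℝ), ∀ x : ℝ, 0 < x → x < δ →
      0 < x - c₁ * x * x ^ γ - c₂ * x ^ r₁ - c₃ * x ^ r₂ := by
  have hcont : ContinuousAt
      (fun x : ℝ => c₁ * x ^ γ + c₂ * x ^ (r₁ - 1) + c₃ * x ^ (r₂ - 1)) 0 :=
    (((Real.continuousAt_rpow_const 0 γ (.inr hγ₀.le)).const_mul c₁).add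
      ((Real.continuousAt_rpow_const 0 (r₁ - 1) (.inr (by linarith))).const_mul c₂)).add
      ((Real.continuousAt_rpow_const 0 (r₂ - 1) (.inr (by linarith))).const_mul c₃)
  have hev := hcont.eventually_lt (continuousAt_const (y := (1 : ℝ))) (by
    simp [Real.zero_rpow hγ₀.ne', Real.zero_rpow (sub_pos.2 hr₁).ne',
      Real.zero_rpow (sub_pos.2 hr₂).ne'])
  obtain ⟨δ, hδ, hball⟩ := Metric.eventually_nhds_iff.1 hev
  refine ⟨δ, hδ, fun x hx hxδ => ?_⟩
  have hlt := hball (y := x) (by rwa [Real.dist_0_eq_abs, abs_of_pos hx])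
  have hpow (r : ℝ) : x ^ r = x * x ^ (r - 1) := by
    rw [Real.rpow_sub_one hx.ne']
    field_simp
  rw [hpow r₁, hpow r₂]
  have hmul := mul_pos hx (sub_pos.2 hlt)
  linarith

/-- First sign change of the truncation function
`g_λ(t) = t − c₁ λ t^γ − c₂ t^{r₁} − c₃ t^{r₂}`: there is `λ⋆ > 0` such that for every
`λ ∈ (0, λ⋆)` the set `{t > 0 : g_λ(t) > 0}` is nonempty and its infimum `R₁(λ)`
satisfies `0 < R₁(λ) ≤ λ`; in particular `R₁(λ) → 0` as `λ → 0⁺`. -/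
theorem stmt_7 (γ r₁ r₂ c₁ c₂ c₃ : ℝ)
    (hγ₀ : 0 < γ) (hγ₁ : γ < 1) (hr₁ : 1 < r₁) (hr₂ : 1 < r₂)
    (hc₁ : 0 < c₁) (hc₂ : 0 < c₂) (hc₃ : 0 < c₃) :
    ∃ lamstar > (0 : ℝ),
      (∀ lam : ℝ, 0 < lam → lam < lamstar →
        ({t : ℝ | 0 < t ∧ 0 < t - c₁ * lam * t ^ γ - c₂ * t ^ r₁ - c₃ * t ^ r₂}.Nonempty ∧
          0 < sInf {t : ℝ | 0 < t ∧ 0 < t - c₁ * lam * t ^ γ - c₂ * t ^ r₁ - c₃ * t ^ r₂} ∧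
          sInf {t : ℝ | 0 < t ∧ 0 < t - c₁ * lam * t ^ γ - c₂ * t ^ r₁ - c₃ * t ^ r₂} ≤ lam)) ∧
      Tendsto
        (fun lam : ℝ =>
          sInf {t : ℝ | 0 < t ∧ 0 < t - c₁ * lam * t ^ γ - c₂ * t ^ r₁ - c₃ * t ^ r₂})
        (nhdsWithin 0 (Set.Ioi 0)) (nhds 0) := by
  obtain ⟨δ, hδ, hself⟩ := exists_truncation_self_pos c₁ c₂ c₃ hγ₀ hr₁ hr₂
  have key : ∀ lam : ℝ, 0 < lam → lam < δ →
      ({t : ℝ | 0 < t ∧ 0 < t - c₁ * lam * t ^ γ - c₂ * t ^ r₁ - c₃ * t ^ r₂}.Nonempty ∧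
        0 < sInf {t : ℝ | 0 < t ∧ 0 < t - c₁ * lam * t ^ γ - c₂ * t ^ r₁ - c₃ * t ^ r₂} ∧
        sInf {t : ℝ | 0 < t ∧ 0 < t - c₁ * lam * t ^ γ - c₂ * t ^ r₁ - c₃ * t ^ r₂} ≤ lam) := by
    intro lam hlam hlt
    have hmem : lam ∈ {t : ℝ | 0 < t ∧
        0 < t - c₁ * lam * t ^ γ - c₂ * t ^ r₁ - c₃ * t ^ r₂} := ⟨hlam, hself lam hlam hlt⟩
    refine ⟨⟨lam, hmem⟩, ?_, csInf_le ⟨0, fun t ht => ht.1.le⟩ hmem⟩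
    exact (Real.rpow_pos_of_pos (mul_pos hc₁ hlam) (1 - γ)⁻¹).trans_le
      (le_csInf ⟨lam, hmem⟩ fun t ht =>
        rpow_le_of_truncation_pos hγ₁ hc₁ hc₂ hc₃ hlam ht.1 ht.2)
  refine ⟨δ, hδ, key, ?_⟩
  have hsmall : ∀ᶠ lam : ℝ in nhdsWithin 0 (Set.Ioi 0), lam ∈ Set.Ioo 0 δ :=
    Ioo_mem_nhdsGT hδ
  refine tendsto_of_tendsto_of_tendsto_of_le_of_le' tendsto_const_nhds
    (tendsto_id.mono_left nhdsWithin_le_nhds) ?_ ?_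
  · filter_upwards [hsmall] with lam h using (key lam h.1 h.2).2.1.le
  · filter_upwards [hsmall] with lam h using (key lam h.1 h.2).2.2
end

section
/- Let p, q, a, b be positive real numbers with γ := a/p + b/q > 1, let p⋆ > p and q⋆ > q be real numbers, and let λ₀ > 0. Let (λ_j) be a sequence of reals with λ_j ≥ λ₀ for all j, and let (A_j), (B_j), (J_j), (P_j), (Q_j) be sequences of nonnegative reals satisfying, as j → ∞: (i) A_j/p + B_j/q − λ_j J_j/(a+b) − P_j/p⋆ − Q_j/q⋆ → 0; (ii) A_j − λ_j a J_j/(a+b) − P_j = 0 for all j; (iii) B_j − λ_j b J_j/(a+b) − Q_j = 0 for all j. Then A_j → 0, B_j → 0, J_j → 0, P_j → 0, and Q_j → 0. -/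
open Filter

/-- A nonnegative function, a positive multiple of which is dominated by a function tending to
`0`, tends to `0`. -/
theorem tendsto_zero_of_const_mul_le {ι : Type*} {l : Filter ι} {x e : ι → ℝ} {c : ℝ}
    (hc : 0 < c) (hx : ∀ j, 0 ≤ x j) (h : ∀ j, c * x j ≤ e j) (he : Tendsto e l (nhds 0)) :
    Tendsto x l (nhds 0) := by
  refine squeeze_zero hx (fun j => (le_div_iff₀' hc).2 (h j)) ?_
  simpa using he.div_const c

/-- The elementary limit lemma in the final step of the proof of Theorem 1.4:
if `γ = a/p + b/q > 1`, `λ_j ≥ λ₀ > 0`, and the nonnegative sequences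
`A_j, B_j, J_j, P_j, Q_j` satisfy the energy relation (i) and the critical point
relations (ii), (iii), then all five sequences tend to `0`. -/
theorem stmt_11 (p q a b pstar qstar lam₀ : ℝ)
    (hp : 0 < p) (hq : 0 < q) (ha : 0 < a) (hb : 0 < b)
    (hγ : 1 < a / p + b / q) (hpstar : p < pstar) (hqstar : q < qstar)
    (hlam₀ : 0 < lam₀)
    (lam A B J P Q : ℕ → ℝ)
    (hlam : ∀ j, lam₀ ≤ lam j)
    (hA : ∀ j, 0 ≤ A j) (hB : ∀ j, 0 ≤ B j) (hJ : ∀ j, 0 ≤ J j)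
    (hP : ∀ j, 0 ≤ P j) (hQ : ∀ j, 0 ≤ Q j)
    (hi : Tendsto (fun j => A j / p + B j / q - lam j * J j / (a + b)
      - P j / pstar - Q j / qstar) atTop (nhds 0))
    (hii : ∀ j, A j - lam j * a * J j / (a + b) - P j = 0)
    (hiii : ∀ j, B j - lam j * b * J j / (a + b) - Q j = 0) :
    Tendsto A atTop (nhds 0) ∧ Tendsto B atTop (nhds 0) ∧
    Tendsto J atTop (nhds 0) ∧ Tendsto P atTop (nhds 0) ∧
    Tendsto Q atTop (nhds 0) := by
  have hab : 0 < a + b := add_pos ha hb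
  have hcP : 0 < 1 / p - 1 / pstar := sub_pos.2 (one_div_lt_one_div_of_lt hp hpstar)
  have hcQ : 0 < 1 / q - 1 / qstar := sub_pos.2 (one_div_lt_one_div_of_lt hq hqstar)
  have hcL : 0 < a / p + b / q - 1 := sub_pos.2 hγ
  obtain ⟨L, hL⟩ : ∃ L : ℕ → ℝ, ∀ j, L j = lam j * J j / (a + b) := ⟨_, fun _ => rfl⟩
  have hL0 : ∀ j, 0 ≤ L j := fun j => by
    rw [hL]
    exact div_nonneg (mul_nonneg (hlam₀.le.trans (hlam j)) (hJ j)) hab.le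
  have hAeq : ∀ j, A j = a * L j + P j := fun j => by
    rw [hL]
    linear_combination hii j
  have hBeq : ∀ j, B j = b * L j + Q j := fun j => by
    rw [hL]
    linear_combination hiii j
  have hE : ∀ j, A j / p + B j / q - lam j * J j / (a + b) - P j / pstar - Q j / qstar =
      (a / p + b / q - 1) * L j + (1 / p - 1 / pstar) * P j + (1 / q - 1 / qstar) * Q j :=
    fun j => by
      rw [← hL, hAeq, hBeq]
      ring
  simp only [hE] at hi
  have hnL := fun j => mul_nonneg hcL.le (hL0 j)
  have hnP := fun j => mul_nonneg hcP.le (hP j)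
  have hnQ := fun j => mul_nonneg hcQ.le (hQ j)
  have tL : Tendsto L atTop (nhds 0) :=
    tendsto_zero_of_const_mul_le hcL hL0 (fun j => by linarith [hnP j, hnQ j]) hi
  have tP : Tendsto P atTop (nhds 0) :=
    tendsto_zero_of_const_mul_le hcP hP (fun j => by linarith [hnL j, hnQ j]) hi
  have tQ : Tendsto Q atTop (nhds 0) :=
    tendsto_zero_of_const_mul_le hcQ hQ (fun j => by linarith [hnL j, hnP j]) hi
  refine ⟨?_, ?_, ?_, tP, tQ⟩
  · rw [funext hAeq]
    simpa using (tL.const_mul a).add tP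
  · rw [funext hBeq]
    simpa using (tL.const_mul b).add tQ
  · refine tendsto_zero_of_const_mul_le (div_pos hlam₀ hab) hJ (fun j => ?_) tL
    rw [hL, div_mul_eq_mul_div]
    gcongr
    · exact hJ j
    · exact hlam j
end
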